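/- arXiv:2205.15920 — 9 statements merged into one kernel-verified Lean document; each statement's English description precedes it below -/
import Mathlib

section
/- Let (X,d) be a metric space, n ≥ 2, and let x_1, …, x_n ∈ X be points that are not all identical. Let D ∈ ℝ^{n×n} be the distance matrix D_{ij} = d(x_i, x_j), and let v ∈ ℝ^n be an eigenvector of D with nonnegative entries and unit Euclidean norm ‖v‖ = 1, associated to the largest eigenvalue λ₁ of D. Then every entry of v satisfies v_i ≥ 1/(2√n). -/
open Finset

/-- A nonnegative eigenvector of a distance matrix of points that are not all identical has a
positive eigenvalue. -/
lemma eigenvalue_pos_of_nonneg_eigenvector {X ι : Type*} [MetricSpace X] [Fintype ι]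
    {x : ι → X} (hx : ∃ i j, x i ≠ x j) {lam : ℝ} {v : ι → ℝ} (hv : ∀ i, 0 ≤ v i) (hv0 : v ≠ 0)
    (heig : ∀ i, ∑ j, dist (x i) (x j) * v j = lam * v i) : 0 < lam := by
  obtain ⟨j, hj⟩ := Function.ne_iff.mp hv0
  have hvj : 0 < v j := lt_of_le_of_ne (hv j) (Ne.symm hj)
  obtain ⟨i, hi⟩ : ∃ i, x i ≠ x j := by
    by_contra! h
    obtain ⟨a, b, hab⟩ := hx
    exact hab ((h a).trans (h b).symm)
  have hle : dist (x i) (x j) * v j ≤ ∑ k, dist (x i) (x k) * v k :=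
    Finset.single_le_sum (f := fun k => dist (x i) (x k) * v k)
      (fun k _ => mul_nonneg dist_nonneg (hv k)) (Finset.mem_univ j)
  have hpos : 0 < lam * v i := heig i ▸ (mul_pos (dist_pos.mpr hi) hvj).trans_le hle
  exact pos_of_mul_pos_left hpos (hv i)

/-- Bounding each distance through the point `x i` bounds the quadratic form of a distance matrix
at a nonnegative vector. -/
lemma sum_dist_mul_mul_le {X ι : Type*} [PseudoMetricSpace X] [Fintype ι]
    (x : ι → X) {v : ι → ℝ} (hv : ∀ i, 0 ≤ v i) (i : ι) :
    ∑ j, (∑ k, dist (x j) (x k) * v k) * v j ≤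
      2 * (∑ j, v j) * ∑ j, dist (x i) (x j) * v j := by
  calc ∑ j, (∑ k, dist (x j) (x k) * v k) * v j
      ≤ ∑ j, (∑ k, (dist (x i) (x j) + dist (x i) (x k)) * v k) * v j := by
        gcongr with j _ k _
        · exact hv j
        · exact hv k
        · exact dist_triangle_left _ _ _
    _ = ∑ j, ((dist (x i) (x j) * v j) * (∑ k, v k) +
          v j * ∑ k, dist (x i) (x k) * v k) := by
        refine Finset.sum_congr rfl fun j _ => ?_
        simp only [add_mul, Finset.sum_add_distrib, ← Finset.mul_sum]
        ring
    _ = 2 * (∑ j, v j) * ∑ j, dist (x i) (x j) * v j := by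
        rw [Finset.sum_add_distrib, ← Finset.sum_mul, ← Finset.sum_mul]
        ring

/-- The first eigenvector of a distance matrix is nearly constant:
each entry of the unit-norm nonnegative eigenvector associated to the largest
eigenvalue of the distance matrix of `n` (not all identical) points in a metric
space is at least `1/(2√n)`. -/
theorem entry_lower_bound {X : Type*} [MetricSpace X] (n : ℕ) (hn : 2 ≤ n)
    (x : Fin n → X) (hx : ∃ i j, x i ≠ x j)
    (D : Matrix (Fin n) (Fin n) ℝ) (hD : ∀ i j, D i j = dist (x i) (x j))
    (lam1 : ℝ) (v : Fin n → ℝ)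
    (hv_nonneg : ∀ i, 0 ≤ v i)
    (hv_unit : ∑ i, v i ^ 2 = 1)
    (hv_eig : D.mulVec v = lam1 • v)
    (hmax : ∀ μ : ℝ, (∃ w : Fin n → ℝ, w ≠ 0 ∧ D.mulVec w = μ • w) → μ ≤ lam1) :
    ∀ i, v i ≥ 1 / (2 * Real.sqrt n) := by
  intro i
  have heig : ∀ i, ∑ j, dist (x i) (x j) * v j = lam1 * v i := fun i => by
    simpa [Matrix.mulVec, dotProduct, hD] using congrFun hv_eig i
  have hv0 : v ≠ 0 := by
    rintro rfl
    simp at hv_unit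
  have hlam : 0 < lam1 := eigenvalue_pos_of_nonneg_eigenvector hx hv_nonneg hv0 heig
  have hform := sum_dist_mul_mul_le x hv_nonneg i
  simp only [heig, mul_assoc, ← Finset.mul_sum, ← sq, hv_unit] at hform
  have hone : 1 ≤ 2 * (∑ j, v j) * v i := by
    refine le_of_mul_le_mul_left ?_ hlam
    linarith
  have hsum : ∑ j, v j ≤ Real.sqrt n := by
    refine Real.le_sqrt_of_sq_le ?_
    simpa [hv_unit] using sq_sum_le_card_mul_sum_sq (s := Finset.univ) (f := v)
  have hn0 : (0 : ℝ) < n := by exact_mod_cast (by lia : 0 < n)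
  have hsqrt : 0 < Real.sqrt n := Real.sqrt_pos.mpr hn0
  rw [ge_iff_le, div_le_iff₀ (by positivity)]
  linarith [mul_le_mul_of_nonneg_right hsum (hv_nonneg i)]
end

section
/- Let (X,d) be a metric space, n ≥ 2, and let x_1, …, x_n ∈ X be points that are not all identical. Let D ∈ ℝ^{n×n} be the distance matrix D_{ij} = d(x_i, x_j), and let v ∈ ℝ^n be an eigenvector of D with nonnegative entries and unit Euclidean norm ‖v‖ = 1, associated to the largest eigenvalue λ₁ of D. Then ⟨v, 𝟙⟩ ≥ √n / √2. -/
open Finset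

/-- The first eigenvector of a distance matrix is nearly constant:
the unit-norm nonnegative eigenvector associated to the largest eigenvalue of
the distance matrix of `n` (not all identical) points in a metric space
satisfies `⟨v, 𝟙⟩ ≥ √n / √2`. -/
theorem inner_ones_lower_bound {X : Type*} [MetricSpace X] (n : ℕ) (hn : 2 ≤ n)
    (x : Fin n → X) (hx : ∃ i j, x i ≠ x j)
    (D : Matrix (Fin n) (Fin n) ℝ) (hD : ∀ i j, D i j = dist (x i) (x j))
    (lam1 : ℝ) (v : Fin n → ℝ)
    (hv_nonneg : ∀ i, 0 ≤ v i)
    (hv_unit : ∑ i, v i ^ 2 = 1)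
    (hv_eig : D.mulVec v = lam1 • v)
    (hmax : ∀ μ : ℝ, (∃ w : Fin n → ℝ, w ≠ 0 ∧ D.mulVec w = μ • w) → μ ≤ lam1) :
    ∑ i, v i ≥ Real.sqrt n / Real.sqrt 2 := by
  have hrow (i : Fin n) : ∑ k, dist (x i) (x k) * v k = lam1 * v i := by
    simpa [Matrix.mulVec, dotProduct, hD] using congrFun hv_eig i
  obtain ⟨k, hk⟩ : ∃ k, 0 < v k := by
    by_contra! h
    have hzero (i : Fin n) : v i = 0 := le_antisymm (h i) (hv_nonneg i)
    simp [hzero] at hv_unit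
  have hlam : 0 < lam1 := by
    by_contra! hle
    have hdist (i : Fin n) : x i = x k := by
      have hterm : dist (x i) (x k) * v k ≤ ∑ l, dist (x i) (x l) * v l :=
        single_le_sum (f := fun l => dist (x i) (x l) * v l)
          (fun l _ => mul_nonneg dist_nonneg (hv_nonneg l)) (mem_univ k)
      rw [hrow] at hterm
      have hneg : lam1 * v i ≤ 0 := mul_nonpos_of_nonpos_of_nonneg hle (hv_nonneg i)
      exact dist_le_zero.mp (nonpos_of_mul_nonpos_left (hterm.trans hneg) hk)
    obtain ⟨i, j, hij⟩ := hx
    exact hij ((hdist i).trans (hdist j).symm)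
  set S := ∑ i, v i with hS
  have hS_nonneg : 0 ≤ S := sum_nonneg fun i _ => hv_nonneg i
  have hlip (i j : Fin n) : lam1 * (v i - v j) ≤ dist (x i) (x j) * S := by
    have hsum : ∑ l, dist (x i) (x l) * v l ≤
        ∑ l, (dist (x i) (x j) * v l + dist (x j) (x l) * v l) := by
      refine sum_le_sum fun l _ => ?_
      rw [← add_mul]
      exact mul_le_mul_of_nonneg_right (dist_triangle _ _ _) (hv_nonneg l)
    rw [sum_add_distrib, ← mul_sum, hrow, hrow] at hsum
    linarith
  have hdouble : ∑ j, ∑ i, lam1 * (v i - v j) * v i ≤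
      ∑ j, ∑ i, dist (x i) (x j) * S * v i :=
    sum_le_sum fun j _ => sum_le_sum fun i _ =>
      mul_le_mul_of_nonneg_right (hlip i j) (hv_nonneg i)
  have hleft : ∑ j, ∑ i, lam1 * (v i - v j) * v i = lam1 * (n - S ^ 2) := by
    have hinner (j : Fin n) : ∑ i, lam1 * (v i - v j) * v i = lam1 * (1 - v j * S) := by
      rw [← hv_unit, hS, mul_sum, ← sum_sub_distrib, mul_sum]
      exact sum_congr rfl fun i _ => by ring
    simp_rw [hinner]
    rw [← mul_sum, sum_sub_distrib, ← sum_mul, ← hS]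
    simp [sq]
  have hright : ∑ j, ∑ i, dist (x i) (x j) * S * v i = lam1 * S ^ 2 := by
    have hinner (j : Fin n) : ∑ i, dist (x i) (x j) * S * v i = S * (lam1 * v j) := by
      rw [← hrow, mul_sum]
      exact sum_congr rfl fun i _ => by rw [dist_comm]; ring
    simp_rw [hinner]
    rw [← mul_sum, ← mul_sum, ← hS]
    ring
  rw [hleft, hright] at hdouble
  have hkey : (n : ℝ) - S ^ 2 ≤ S ^ 2 := le_of_mul_le_mul_left hdouble hlam
  rw [ge_iff_le, ← Real.sqrt_div (Nat.cast_nonneg n)]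
  exact Real.sqrt_le_iff.mpr ⟨hS_nonneg, by linarith⟩
end

section
/- Let (X,d) be a metric space, x_1, …, x_n ∈ X, and let D ∈ ℝ^{n×n} be the distance matrix D_{ij} = d(x_i, x_j). Suppose v ∈ ℝ^n has nonnegative entries, ‖v‖ = 1, and Dv = λ v for some λ > 0. Then for every index k we have v_k ≥ 1 / (2 ⟨v, 𝟙⟩). -/
open Finset

/-- If `v` is a nonnegative unit eigenvector of the distance matrix of points in a
metric space with positive eigenvalue `λ`, then every entry satisfies
`v k ≥ 1/(2⟨v,𝟙⟩)`. -/
theorem entry_ge_inv_inner_ones {X : Type*} [MetricSpace X] (n : ℕ)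
    (x : Fin n → X)
    (D : Matrix (Fin n) (Fin n) ℝ) (hD : ∀ i j, D i j = dist (x i) (x j))
    (lam : ℝ) (hlam : 0 < lam) (v : Fin n → ℝ)
    (hv_nonneg : ∀ i, 0 ≤ v i)
    (hv_unit : ∑ i, v i ^ 2 = 1)
    (hv_eig : D.mulVec v = lam • v) :
    ∀ k, v k ≥ 1 / (2 * ∑ i, v i) := by
  intro k
  have heig : ∀ i, ∑ j, dist (x i) (x j) * v j = lam * v i := fun i => by
    simpa [Matrix.mulVec, dotProduct, hD] using congrFun hv_eig i
  set S := ∑ i, v i with hS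
  have hS_nonneg : 0 ≤ S := sum_nonneg fun i _ => hv_nonneg i
  -- the triangle inequality through `x k`, averaged against `v`
  have htri : ∀ i, lam * v i ≤ dist (x k) (x i) * S + lam * v k := fun i => by
    rw [← heig i, ← heig k, hS, mul_sum, ← sum_add_distrib]
    refine sum_le_sum fun j _ => ?_
    rw [← add_mul]
    exact mul_le_mul_of_nonneg_right (dist_triangle_left _ _ _) (hv_nonneg j)
  have hquad : lam ≤ lam * (v k * (2 * S)) := by
    calc lam = ∑ i, lam * v i * v i := by
          simp_rw [mul_assoc, ← pow_two, ← mul_sum, hv_unit, mul_one]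
      _ ≤ ∑ i, (dist (x k) (x i) * S + lam * v k) * v i :=
          sum_le_sum fun i _ => mul_le_mul_of_nonneg_right (htri i) (hv_nonneg i)
      _ = S * ∑ i, dist (x k) (x i) * v i + lam * v k * S := by
          rw [hS, mul_sum, mul_sum _ _ (lam * v k), ← sum_add_distrib]
          exact sum_congr rfl fun i _ => by ring
      _ = lam * (v k * (2 * S)) := by rw [heig k]; ring
  have hone : 1 ≤ v k * (2 * S) := by
    refine le_of_mul_le_mul_left ?_ hlam
    simpa using hquad
  have hS_pos : 0 < S := by
    refine hS_nonneg.lt_of_ne fun h => ?_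
    rw [← h] at hone
    norm_num at hone
  exact (div_le_iff₀ (by positivity)).2 hone
end

section
/- Let D ∈ ℝ^{n×n} be a symmetric matrix with nonnegative entries and at least one positive entry, whose eigenvalues (with multiplicity) satisfy λ₁ > 0 ≥ λ₂ ≥ … ≥ λ_n, and let v₁ be a unit eigenvector with D v₁ = λ₁ v₁. If (λ₁ − λ₂)(1 − ⟨v₁, 𝟙/√n⟩²) + λ₂ < 0, then the quadratic form Q(v) = ⟨v, Dv⟩ attains its supremum over the hyperplane { v ∈ ℝ^n : ⟨v, 𝟙⟩ = 1 } at some point v_max with Q(v_max) > 0. -/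
open Finset

lemma Matrix.IsSymm.dotProduct_mulVec_comm {ι : Type*} [Fintype ι] {D : Matrix ι ι ℝ}
    (hD : D.IsSymm) (x y : ι → ℝ) :
    x ⬝ᵥ D.mulVec y = y ⬝ᵥ D.mulVec x := by
  rw [Matrix.dotProduct_mulVec, ← Matrix.mulVec_transpose, hD.eq, dotProduct_comm]

lemma dotProduct_mulVec_of_eigenvector {ι : Type*} [Fintype ι] {D : Matrix ι ι ℝ}
    (hD : D.IsSymm) {x : ι → ℝ} {μ : ℝ} (hx : D.mulVec x = μ • x) (y : ι → ℝ) :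
    x ⬝ᵥ D.mulVec y = μ * (x ⬝ᵥ y) := by
  rw [hD.dotProduct_mulVec_comm, hx, dotProduct_smul, smul_eq_mul, dotProduct_comm]

section EigenExpansion

variable {ι : Type*} [Fintype ι] [DecidableEq ι] {u : ι → ι → ℝ}

/-- Parseval's identity for an orthonormal family indexed by the coordinates. -/
lemma dotProduct_eq_sum_coeff_mul_coeff
    (hortho : ∀ i j, (∑ k, u i k * u j k) = if i = j then (1 : ℝ) else 0) (x y : ι → ℝ) :
    x ⬝ᵥ y = ∑ i, (u i ⬝ᵥ x) * (u i ⬝ᵥ y) := by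
  have hU : Matrix.of u * (Matrix.of u).transpose = 1 := by
    ext i j
    simp [Matrix.mul_apply, hortho, Matrix.one_apply]
  have hU' : (Matrix.of u).transpose * Matrix.of u = 1 := mul_eq_one_comm.mp hU
  calc x ⬝ᵥ y = x ⬝ᵥ (((Matrix.of u).transpose * Matrix.of u).mulVec y) := by
        rw [hU', Matrix.one_mulVec]
    _ = (Matrix.of u).mulVec x ⬝ᵥ (Matrix.of u).mulVec y := by
        rw [← Matrix.mulVec_mulVec, Matrix.dotProduct_mulVec, Matrix.vecMul_transpose]
    _ = ∑ i, (u i ⬝ᵥ x) * (u i ⬝ᵥ y) := rfl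

/-- If every eigenvalue other than that of `i₀` is at most `μ < lam i₀`, the quadratic form is
bounded by splitting off the component along a unit eigenvector for `lam i₀`. -/
lemma quadraticForm_le_of_eigenbasis {D : Matrix ι ι ℝ} (hD : D.IsSymm) {lam : ι → ℝ}
    (hortho : ∀ i j, (∑ k, u i k * u j k) = if i = j then (1 : ℝ) else 0)
    (heig : ∀ i, D.mulVec (u i) = lam i • u i) {i₀ : ι} {μ : ℝ} (hμ : μ < lam i₀)
    (hle : ∀ i, i ≠ i₀ → lam i ≤ μ) {v : ι → ℝ} (hv : v ⬝ᵥ v = 1)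
    (hveig : D.mulVec v = lam i₀ • v) (w : ι → ℝ) :
    w ⬝ᵥ D.mulVec w ≤ (lam i₀ - μ) * (w ⬝ᵥ v) ^ 2 + μ * (w ⬝ᵥ w) := by
  have hcoeff : ∀ i, i ≠ i₀ → u i ⬝ᵥ v = 0 := by
    intro i hi
    have h := dotProduct_mulVec_of_eigenvector hD (heig i) v
    rw [hveig, dotProduct_smul, smul_eq_mul] at h
    have hne : lam i₀ - lam i ≠ 0 := by linarith [hle i hi]
    exact (mul_eq_zero.mp (by linarith : (lam i₀ - lam i) * (u i ⬝ᵥ v) = 0)).resolve_left hne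
  have hsq : (u i₀ ⬝ᵥ v) ^ 2 = 1 := by
    rw [dotProduct_eq_sum_coeff_mul_coeff hortho, Finset.sum_eq_single i₀
      (fun i _ hi => by rw [hcoeff i hi, zero_mul]) (by simp)] at hv
    rw [sq, hv]
  have hwv : (w ⬝ᵥ v) ^ 2 = (u i₀ ⬝ᵥ w) ^ 2 := by
    rw [dotProduct_eq_sum_coeff_mul_coeff hortho, Finset.sum_eq_single i₀
      (fun i _ hi => by rw [hcoeff i hi, mul_zero]) (by simp), mul_pow, hsq, mul_one]
  rw [hwv, dotProduct_eq_sum_coeff_mul_coeff hortho w w,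
    dotProduct_eq_sum_coeff_mul_coeff hortho w (D.mulVec w),
    ← Finset.add_sum_erase _ _ (Finset.mem_univ i₀),
    ← Finset.add_sum_erase _ (fun i => (u i ⬝ᵥ w) * (u i ⬝ᵥ w)) (Finset.mem_univ i₀),
    dotProduct_mulVec_of_eigenvector hD (heig i₀)]
  have hrest : ∑ i ∈ univ.erase i₀, (u i ⬝ᵥ w) * (u i ⬝ᵥ D.mulVec w)
      ≤ μ * ∑ i ∈ univ.erase i₀, (u i ⬝ᵥ w) * (u i ⬝ᵥ w) := by
    rw [Finset.mul_sum]
    refine Finset.sum_le_sum fun i hi => ?_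
    rw [dotProduct_mulVec_of_eigenvector hD (heig i)]
    nlinarith [mul_le_mul_of_nonneg_right (hle i (Finset.ne_of_mem_erase hi))
      (mul_self_nonneg (u i ⬝ᵥ w))]
  nlinarith

end EigenExpansion

/-- A vector with zero coordinate sum only sees the part of `v` orthogonal to the all-ones
vector. -/
lemma dotProduct_sq_le_of_sum_eq_zero {n : ℕ} (hn : 0 < n) {v w : Fin n → ℝ} (hv : v ⬝ᵥ v = 1)
    (hw : ∑ i, w i = 0) :
    (w ⬝ᵥ v) ^ 2 ≤ (1 - ((∑ i, v i) / Real.sqrt n) ^ 2) * (w ⬝ᵥ w) := by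
  have hn' : (0 : ℝ) < n := by exact_mod_cast hn
  set s := ∑ i, v i with hs
  have hcs := Finset.sum_mul_sq_le_sq_mul_sq univ w (fun i => v i - s / n)
  have hwv : ∑ i, w i * (v i - s / n) = w ⬝ᵥ v := by
    simp only [mul_sub, Finset.sum_sub_distrib, ← Finset.sum_mul, hw, dotProduct]
    ring
  have hproj : ∑ i, (v i - s / n) ^ 2 = 1 - (s / Real.sqrt n) ^ 2 := by
    have hv' : ∑ i, v i ^ 2 = 1 := by simpa [dotProduct, sq] using hv
    simp only [sub_sq, Finset.sum_add_distrib, Finset.sum_sub_distrib, ← Finset.sum_mul,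
      ← Finset.mul_sum, hv', ← hs, Finset.sum_const, Finset.card_univ, Fintype.card_fin,
      nsmul_eq_mul, div_pow, Real.sq_sqrt hn'.le]
    field_simp
    ring
  have hww : ∑ i, w i ^ 2 = w ⬝ᵥ w := by simp [dotProduct, sq]
  rw [hwv, hproj, hww] at hcs
  linarith

/-- A quadratic form that is negative definite on the vectors with zero coordinate sum attains
its supremum over the hyperplane of vectors with coordinate sum one. -/
lemma exists_max_quadraticForm_of_negDef {ι : Type*} [Fintype ι] {D : Matrix ι ι ℝ}
    (hD : D.IsSymm) {c : ℝ} (hc : 0 < c)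
    (hneg : ∀ w : ι → ℝ, ∑ i, w i = 0 → w ⬝ᵥ D.mulVec w ≤ -c * (w ⬝ᵥ w))
    {v₀ : ι → ℝ} (hv₀ : ∑ i, v₀ i = 1) :
    ∃ x : ι → ℝ, ∑ i, x i = 1 ∧
      ∀ v : ι → ℝ, ∑ i, v i = 1 → v ⬝ᵥ D.mulVec v ≤ x ⬝ᵥ D.mulVec x := by
  have hcont : Continuous fun v : ι → ℝ => v ⬝ᵥ D.mulVec v := by
    unfold Matrix.mulVec dotProduct
    fun_prop
  set S : Set (ι → ℝ) := {v | ∑ i, v i = 1 ∧ v₀ ⬝ᵥ D.mulVec v₀ ≤ v ⬝ᵥ D.mulVec v}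
  have hclosed : IsClosed S :=
    (isClosed_eq (by fun_prop) continuous_const).inter (isClosed_le continuous_const hcont)
  set b := D.mulVec v₀
  have hbdd : S ⊆ Metric.closedBall v₀ (Real.sqrt (4 * (b ⬝ᵥ b) / c ^ 2)) := by
    rintro v ⟨hv, hQ⟩
    obtain ⟨w, rfl⟩ : ∃ w, v = v₀ + w := ⟨v - v₀, by simp⟩
    have hw : ∑ i, w i = 0 := by
      simpa [Finset.sum_add_distrib, hv₀] using hv
    have hexpand : (v₀ + w) ⬝ᵥ D.mulVec (v₀ + w)
        = v₀ ⬝ᵥ b + 2 * (w ⬝ᵥ b) + w ⬝ᵥ D.mulVec w := by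
      rw [Matrix.mulVec_add, add_dotProduct, dotProduct_add, dotProduct_add,
        hD.dotProduct_mulVec_comm v₀ w]
      ring
    have hsq : 0 ≤ (c • w - (2 : ℝ) • b) ⬝ᵥ (c • w - (2 : ℝ) • b) :=
      Finset.sum_nonneg fun i _ => mul_self_nonneg _
    simp only [sub_dotProduct, dotProduct_sub, smul_dotProduct, dotProduct_smul, smul_eq_mul,
      dotProduct_comm b w] at hsq
    have hnorm : w ⬝ᵥ w ≤ 4 * (b ⬝ᵥ b) / c ^ 2 := by
      rw [le_div_iff₀ (by positivity)]
      have h := hneg w hw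
      have h' : c * (w ⬝ᵥ w) ≤ 2 * (w ⬝ᵥ b) := by linarith
      nlinarith [mul_le_mul_of_nonneg_left h' hc.le]
    rw [Metric.mem_closedBall, dist_pi_le_iff (Real.sqrt_nonneg _)]
    intro i
    have hi : w i * w i ≤ w ⬝ᵥ w :=
      Finset.single_le_sum (f := fun i => w i * w i) (fun i _ => mul_self_nonneg _)
        (Finset.mem_univ i)
    rw [Real.dist_eq, Pi.add_apply, add_sub_cancel_left]
    exact Real.abs_le_sqrt (by rw [sq]; exact hi.trans hnorm)
  have hcompact : IsCompact S := (isCompact_closedBall _ _).of_isClosed_subset hclosed hbdd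
  obtain ⟨x, hxS, hx⟩ := hcompact.exists_isMaxOn ⟨v₀, hv₀, le_rfl⟩ hcont.continuousOn
  refine ⟨x, hxS.1, fun v hv => ?_⟩
  rcases le_total (v₀ ⬝ᵥ b) (v ⬝ᵥ D.mulVec v) with h | h
  · exact hx ⟨hv, h⟩
  · exact h.trans hxS.2

/-- For a symmetric nonnegative matrix `D` with eigenvalues
`λ₁ > 0 ≥ λ₂ ≥ … ≥ λ_n` (listed with multiplicity via an orthonormal eigenbasis)
and unit eigenvector `v₁` for `λ₁`, if `(λ₁ - λ₂)(1 - ⟨v₁, 𝟙/√n⟩²) + λ₂ < 0`,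
then the quadratic form `Q(v) = ⟨v, Dv⟩` attains its supremum over the
hyperplane `⟨v, 𝟙⟩ = 1` at a point with positive value. -/
theorem max_attained (n : ℕ) (hn : 2 ≤ n) (D : Matrix (Fin n) (Fin n) ℝ)
    (hsymm : D.IsSymm)
    (hnonneg : ∀ i j, 0 ≤ D i j) (hpos : ∃ i j, 0 < D i j)
    (lam : Fin n → ℝ) (u : Fin n → Fin n → ℝ)
    (hanti : Antitone lam)
    (hortho : ∀ i j, (∑ k, u i k * u j k) = if i = j then (1 : ℝ) else 0)
    (heig : ∀ i, D.mulVec (u i) = lam i • u i)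
    (hlam1 : 0 < lam ⟨0, by omega⟩) (hlam2 : lam ⟨1, by omega⟩ ≤ 0)
    (v₁ : Fin n → ℝ) (hv₁_unit : ∑ i, v₁ i ^ 2 = 1)
    (hv₁_eig : D.mulVec v₁ = lam ⟨0, by omega⟩ • v₁)
    (hcond : (lam ⟨0, by omega⟩ - lam ⟨1, by omega⟩)
        * (1 - ((∑ i, v₁ i) / Real.sqrt n) ^ 2) + lam ⟨1, by omega⟩ < 0) :
    ∃ vmax : Fin n → ℝ, (∑ i, vmax i = 1) ∧
      (∀ v : Fin n → ℝ, (∑ i, v i = 1) →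
        ∑ i, v i * D.mulVec v i ≤ ∑ i, vmax i * D.mulVec vmax i) ∧
      0 < ∑ i, vmax i * D.mulVec vmax i := by
  have hn' : (0 : ℝ) < n := by exact_mod_cast (by omega : 0 < n)
  have hv : v₁ ⬝ᵥ v₁ = 1 := by simpa [dotProduct, sq] using hv₁_unit
  have hle : ∀ i : Fin n, i ≠ ⟨0, by omega⟩ → lam i ≤ lam ⟨1, by omega⟩ := by
    intro i hi
    refine hanti (Fin.mk_le_of_le_val ?_)
    exact Nat.one_le_iff_ne_zero.mpr fun h => hi (Fin.ext h)
  have hgap : lam ⟨1, by omega⟩ < lam ⟨0, by omega⟩ := hlam2.trans_lt hlam1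
  have hneg : ∀ w : Fin n → ℝ, ∑ i, w i = 0 → w ⬝ᵥ D.mulVec w ≤
      -(-((lam ⟨0, by omega⟩ - lam ⟨1, by omega⟩)
        * (1 - ((∑ i, v₁ i) / Real.sqrt n) ^ 2) + lam ⟨1, by omega⟩)) * (w ⬝ᵥ w) := by
    intro w hw
    have hQ := quadraticForm_le_of_eigenbasis hsymm hortho heig hgap hle hv hv₁_eig w
    have hproj := mul_le_mul_of_nonneg_left
      (dotProduct_sq_le_of_sum_eq_zero (by omega) hv hw) (sub_pos.mpr hgap).le
    linarith
  have hmean : ∑ _i : Fin n, (n : ℝ)⁻¹ = 1 := by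
    simp [hn'.ne']
  obtain ⟨x, hx, hmax⟩ :=
    exists_max_quadraticForm_of_negDef hsymm (neg_pos.mpr hcond) hneg hmean
  refine ⟨x, hx, hmax, lt_of_lt_of_le ?_ (hmax _ hmean)⟩
  obtain ⟨i, j, hij⟩ := hpos
  have hrow : ∀ k, 0 ≤ D.mulVec (fun _ => (n : ℝ)⁻¹) k := fun k => by
    rw [Matrix.mulVec, dotProduct]
    exact Finset.sum_nonneg fun l _ => mul_nonneg (hnonneg k l) (by positivity)
  refine Finset.sum_pos' (fun k _ => mul_nonneg (by positivity) (hrow k))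
    ⟨i, Finset.mem_univ i, mul_pos (by positivity) ?_⟩
  rw [Matrix.mulVec, dotProduct]
  exact Finset.sum_pos' (fun l _ => mul_nonneg (hnonneg i l) (by positivity))
    ⟨j, Finset.mem_univ j, mul_pos hij (by positivity)⟩
end

section
/- For each integer n ≥ 2, let θ_n be the unique positive real number satisfying tanh(θ_n/2) · tanh(n θ_n/2) = 1/n. Then lim_{n→∞} n θ_n / 2 = c, where c is the unique positive solution of c · tanh(c) = 1. -/
open Filter

theorem Real.strictMono_tanh : StrictMono Real.tanh := by
  intro x y hxy
  rw [Real.tanh_eq_sinh_div_cosh, Real.tanh_eq_sinh_div_cosh,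
    div_lt_div_iff₀ (Real.cosh_pos x) (Real.cosh_pos y)]
  have h : 0 < Real.sinh (y - x) := Real.sinh_pos_iff.2 (sub_pos.2 hxy)
  rw [Real.sinh_sub] at h
  linarith

theorem Real.tanh_pos_of_pos {x : ℝ} (hx : 0 < x) : 0 < Real.tanh x := by
  simpa using Real.strictMono_tanh hx

theorem Real.hasDerivAt_tanh_zero : HasDerivAt Real.tanh 1 0 := by
  have h := (Real.hasDerivAt_sinh 0).div (Real.hasDerivAt_cosh 0) (Real.cosh_pos 0).ne'
  have heq : Real.tanh = Real.sinh / Real.cosh := by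
    ext x
    exact Real.tanh_eq_sinh_div_cosh x
  rw [heq]
  simpa using h

theorem Real.tendsto_nat_mul_tanh_div (x : ℝ) :
    Tendsto (fun n : ℕ => n * Real.tanh (x / n)) atTop (nhds x) := by
  have hd : HasDerivAt (fun h : ℝ => Real.tanh (h * x)) x 0 := by
    have h0 : HasDerivAt Real.tanh 1 (0 * x) := by
      simpa using Real.hasDerivAt_tanh_zero
    simpa [Function.comp_def] using h0.comp (0 : ℝ) ((hasDerivAt_id (0 : ℝ)).mul_const x)
  have hinv : Tendsto (fun n : ℕ => (n : ℝ)⁻¹) atTop (nhdsWithin 0 {0}ᶜ) := by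
    refine tendsto_nhdsWithin_iff.2 ⟨tendsto_inv_atTop_nhds_zero_nat, ?_⟩
    filter_upwards [eventually_gt_atTop 0] with n hn
    simpa using hn.ne'
  simpa [Function.comp_def, div_eq_inv_mul] using hd.tendsto_slope_zero.comp hinv

/-- The map `x ↦ n tanh(x/n) tanh x` is strictly increasing on the positive reals. -/
theorem Real.strictMonoOn_nat_mul_tanh_div_mul_tanh {n : ℕ} (hn : 0 < n) :
    StrictMonoOn (fun x : ℝ => n * Real.tanh (x / n) * Real.tanh x) (Set.Ioi 0) := by
  intro x hx y hy hxy
  have hnpos : (0 : ℝ) < n := Nat.cast_pos.2 hn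
  have hdiv : Real.tanh (x / n) < Real.tanh (y / n) :=
    Real.strictMono_tanh (div_lt_div_of_pos_right hxy hnpos)
  have hxpos := Real.tanh_pos_of_pos hx
  have hxnpos := Real.tanh_pos_of_pos (div_pos hx hnpos)
  exact mul_lt_mul'' (mul_lt_mul_of_pos_left hdiv hnpos) (Real.strictMono_tanh hxy)
    (mul_pos hnpos hxnpos).le hxpos.le

/-- If `θ n` is, for each `n ≥ 2`, the (unique) positive solution of
`tanh(θ/2)·tanh(nθ/2) = 1/n`, then `nθ_n/2 → c` as `n → ∞`, where `c` is the
(unique) positive solution of `c·tanh c = 1`. -/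
theorem theta_limit (θ : ℕ → ℝ)
    (hθ : ∀ n : ℕ, 2 ≤ n → 0 < θ n ∧
      Real.tanh (θ n / 2) * Real.tanh (n * θ n / 2) = 1 / n)
    (c : ℝ) (hc : 0 < c) (hc1 : c * Real.tanh c = 1) :
    Tendsto (fun n : ℕ => n * θ n / 2) atTop (nhds c) := by
  have hpos : ∀ n : ℕ, 2 ≤ n → 0 < n * θ n / 2 := fun n hn => by
    have := (hθ n hn).1
    positivity
  have hval : ∀ n : ℕ, 2 ≤ n →
      n * Real.tanh (n * θ n / 2 / n) * Real.tanh (n * θ n / 2) = 1 := fun n hn => by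
    have hn0 : (n : ℝ) ≠ 0 := by positivity
    have harg : n * θ n / 2 / n = θ n / 2 := by field_simp
    rw [harg, mul_assoc, (hθ n hn).2, mul_one_div_cancel hn0]
  have hlim (x : ℝ) : Tendsto (fun n : ℕ => n * Real.tanh (x / n) * Real.tanh x) atTop
      (nhds (x * Real.tanh x)) := (Real.tendsto_nat_mul_tanh_div x).mul_const _
  refine tendsto_order.2 ⟨fun a ha => ?_, fun b hb => ?_⟩
  · rcases le_or_gt a 0 with ha0 | ha0
    · filter_upwards [eventually_ge_atTop 2] with n hn
      exact ha0.trans_lt (hpos n hn)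
    · have ha1 : a * Real.tanh a < 1 := hc1 ▸ mul_lt_mul'' ha (Real.strictMono_tanh ha) ha0.le
        (Real.tanh_pos_of_pos ha0).le
      filter_upwards [eventually_ge_atTop 2, (hlim a).eventually_lt_const ha1] with n hn hlt
      rw [← hval n hn] at hlt
      exact ((Real.strictMonoOn_nat_mul_tanh_div_mul_tanh (by omega)).lt_iff_lt ha0
        (hpos n hn)).1 hlt
  · have hb1 : 1 < b * Real.tanh b := hc1 ▸ mul_lt_mul'' hb (Real.strictMono_tanh hb) hc.le
      (Real.tanh_pos_of_pos hc).le
    filter_upwards [eventually_ge_atTop 2, (hlim b).eventually_const_lt hb1] with n hn hlt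
    rw [← hval n hn] at hlt
    exact ((Real.strictMonoOn_nat_mul_tanh_div_mul_tanh (by omega)).lt_iff_lt (hpos n hn)
      (hc.trans hb)).1 hlt
end

section
/- Fix an integer n ≥ 2 and let θ > 0 satisfy tanh(θ/2) · tanh(n θ/2) = 1/n. Let D ∈ ℝ^{n×n} be the distance matrix of the path graph P_n, i.e. D_{jk} = |j − k| for 1 ≤ j,k ≤ n, and define v ∈ ℝ^n by v_k = cosh((k − (n+1)/2) θ). Then v is an eigenvector of D: there exists λ > 0 with Dv = λ v. -/
open Finset

/-- The second difference of `|a - x|` on the integers is twice the indicator of `a`. -/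
lemma abs_second_difference (j m : ℕ) :
    |(j : ℝ) - m + 1| + |(j : ℝ) - m - 1| - 2 * |(j : ℝ) - m| = if j = m then 2 else 0 := by
  rcases lt_trichotomy j m with h | rfl | h
  · have h' : (j : ℝ) + 1 ≤ m := by exact_mod_cast h
    rw [if_neg h.ne, abs_of_nonpos (by linarith), abs_of_nonpos (by linarith),
      abs_of_nonpos (by linarith)]
    ring
  · norm_num
  · have h' : (m : ℝ) + 1 ≤ j := by exact_mod_cast h
    rw [if_neg h.ne', abs_of_nonneg (by linarith), abs_of_nonneg (by linarith),
      abs_of_nonneg (by linarith)]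
    ring

/-- Summation by parts of a second difference against the distance to `j`. -/
lemma sum_abs_mul_second_difference (f : ℝ → ℝ) (j m : ℕ) :
    ∑ k ∈ range m, |(j : ℝ) - k| * (f (k + 1) + f (k - 1) - 2 * f k) =
      (if j < m then 2 * f j else 0) + |(j : ℝ) - m + 1| * f m - |(j : ℝ) - m| * f (m - 1)
        + j * f (-1) - (j + 1) * f 0 := by
  induction m with
  | zero =>
    have h : |(j : ℝ) + 1| = j + 1 := abs_of_nonneg (by positivity)
    simp [h]
  | succ m ih =>
    have hif : (if j < m + 1 then 2 * f j else 0) =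
        (if j < m then 2 * f j else 0) + (if j = m then 2 else 0) * f m := by
      rcases lt_trichotomy j m with h | rfl | h
      · simp [h, h.ne, h.trans m.lt_succ_self]
      · simp
      · simp [h.ne', h.not_gt, Nat.not_lt.2 (Nat.succ_le_of_lt h)]
    have h₁ : (j : ℝ) - (m + 1) + 1 = j - m := by ring
    have h₂ : (j : ℝ) - (m + 1) = j - m - 1 := by ring
    rw [sum_range_succ, ih, hif, ← abs_second_difference]
    push_cast
    rw [h₁, h₂, add_sub_cancel_right]
    ring

/-- The equation for `θ` makes the boundary terms of the summation by parts cancel. -/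
lemma boundary_eq_of_tanh_mul_tanh {n θ : ℝ} (hn : n ≠ 0)
    (h : Real.tanh (θ / 2) * Real.tanh (n * θ / 2) = 1 / n) :
    (n - 1) * Real.cosh ((n + 1) / 2 * θ) = (n + 1) * Real.cosh ((n - 1) / 2 * θ) := by
  have h₁ := (Real.cosh_pos (θ / 2)).ne'
  have h₂ := (Real.cosh_pos (n * θ / 2)).ne'
  rw [Real.tanh_eq_sinh_div_cosh, Real.tanh_eq_sinh_div_cosh, div_mul_div_comm,
    div_eq_div_iff (mul_ne_zero h₁ h₂) hn] at h
  rw [show (n + 1) / 2 * θ = n * θ / 2 + θ / 2 by ring,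
    show (n - 1) / 2 * θ = n * θ / 2 - θ / 2 by ring, Real.cosh_add, Real.cosh_sub]
  linear_combination 2 * h

/-- (Ruzieh–Powers) For the distance matrix `D_{jk} = |j - k|` of the path graph
`P_n` and `θ > 0` with `tanh(θ/2)·tanh(nθ/2) = 1/n`, the vector
`v_k = cosh((k - (n+1)/2)θ)` (vertices indexed `1, …, n`) is an eigenvector of
`D` with a positive eigenvalue. -/
theorem path_graph_eigenvector (n : ℕ) (hn : 2 ≤ n) (θ : ℝ) (hθ : 0 < θ)
    (hθeq : Real.tanh (θ / 2) * Real.tanh (n * θ / 2) = 1 / n)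
    (D : Matrix (Fin n) (Fin n) ℝ)
    (hD : ∀ j k : Fin n, D j k = |(j : ℝ) - (k : ℝ)|)
    (v : Fin n → ℝ)
    (hv : ∀ k : Fin n, v k = Real.cosh (((k : ℝ) + 1 - (n + 1) / 2) * θ)) :
    ∃ lam : ℝ, 0 < lam ∧ D.mulVec v = lam • v := by
  have hn₀ : (n : ℝ) ≠ 0 := by positivity
  have hpos : 0 < Real.cosh θ - 1 := sub_pos.2 (Real.one_lt_cosh.2 hθ.ne')
  refine ⟨1 / (Real.cosh θ - 1), by positivity, ?_⟩
  ext j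
  set f : ℝ → ℝ := fun x => Real.cosh ((x + 1 - (n + 1) / 2) * θ) with hf
  have hdiff (x : ℝ) : f (x + 1) + f (x - 1) - 2 * f x = 2 * (Real.cosh θ - 1) * f x := by
    simp only [hf]
    rw [show (x + 1 + 1 - ((n : ℝ) + 1) / 2) * θ = (x + 1 - (n + 1) / 2) * θ + θ by ring,
      show (x - 1 + 1 - ((n : ℝ) + 1) / 2) * θ = (x + 1 - (n + 1) / 2) * θ - θ by ring,
      Real.cosh_add, Real.cosh_sub]
    ring
  have hfn : f n = Real.cosh ((n + 1) / 2 * θ) := by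
    simp only [hf]; congr 1; ring
  have hfn' : f (n - 1) = Real.cosh ((n - 1) / 2 * θ) := by
    simp only [hf]; congr 1; ring
  have hf₀ : f 0 = Real.cosh ((n - 1) / 2 * θ) := by
    simp only [hf]; rw [← Real.cosh_neg]; congr 1; ring
  have hf₁ : f (-1) = Real.cosh ((n + 1) / 2 * θ) := by
    simp only [hf]; rw [← Real.cosh_neg]; congr 1; ring
  have hj : (j : ℝ) + 1 ≤ n := by exact_mod_cast j.isLt
  have hsum := sum_abs_mul_second_difference f j n
  rw [if_pos j.isLt, abs_of_nonpos (by linarith), abs_of_nonpos (by linarith),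
    hfn, hfn', hf₀, hf₁] at hsum
  have hmul : D.mulVec v j = ∑ k ∈ range n, |(j : ℝ) - k| * f k := by
    rw [← Fin.sum_univ_eq_sum_range (fun k : ℕ => |(j : ℝ) - k| * f k) n]
    simp only [Matrix.mulVec, dotProduct, hD, hv, hf]
  have hscale : ∑ k ∈ range n, |(j : ℝ) - k| * (f (k + 1) + f (k - 1) - 2 * f k) =
      2 * (Real.cosh θ - 1) * D.mulVec v j := by
    rw [hmul, mul_sum]
    refine sum_congr rfl fun k _ => ?_
    rw [hdiff]
    ring
  have hvj : v j = f j := hv j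
  rw [Pi.smul_apply, smul_eq_mul, hvj, div_mul_eq_mul_div, one_mul, eq_div_iff hpos.ne']
  linear_combination (hsum - hscale + boundary_eq_of_tanh_mul_tanh hn₀ hθeq) / 2
end

section
/- Let n ≥ 3 and let D ∈ ℝ^{n×n} be the distance matrix of the star graph on n vertices: with vertex 1 the center, D_{1j} = D_{j1} = 1 for 2 ≤ j ≤ n, D_{jk} = 2 for distinct j,k ≥ 2, and D_{jj} = 0. Then the largest eigenvalue of D equals (n−2) + √((n−2)² + (n−1)). -/
open Finset

section StarDistance

variable {m : ℕ} {D : Matrix (Fin (m + 1)) (Fin (m + 1)) ℝ}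

/-- The center row of the star distance matrix sums the leaf coordinates. -/
lemma star_mulVec_zero
    (hD : ∀ i j : Fin (m + 1), D i j =
      if i = j then 0 else if i.val = 0 ∨ j.val = 0 then 1 else 2)
    (w : Fin (m + 1) → ℝ) : D.mulVec w 0 = ∑ j : Fin m, w j.succ := by
  simp [Matrix.mulVec, dotProduct, Fin.sum_univ_succ, hD, (Fin.succ_ne_zero _).symm]

/-- The action of a leaf row of the star distance matrix. -/
lemma star_mulVec_succ
    (hD : ∀ i j : Fin (m + 1), D i j =
      if i = j then 0 else if i.val = 0 ∨ j.val = 0 then 1 else 2)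
    (w : Fin (m + 1) → ℝ) (i : Fin m) :
    D.mulVec w i.succ = w 0 + 2 * ∑ j : Fin m, w j.succ - 2 * w i.succ := by
  have hrow : ∀ j : Fin m, D i.succ j.succ * w j.succ =
      2 * w j.succ - if i = j then 2 * w j.succ else 0 := by
    intro j
    by_cases h : i = j <;> simp [hD, h]
  have hcenter : D i.succ 0 = 1 := by simp [hD]
  simp only [Matrix.mulVec, dotProduct, Fin.sum_univ_succ, hrow, hcenter,
    Finset.sum_sub_distrib, ← Finset.mul_sum, Finset.sum_ite_eq, Finset.mem_univ, if_true]
  ring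

end StarDistance

/-- The largest eigenvalue of the distance matrix of the star graph on `n ≥ 3`
vertices (vertex `1` the center) equals `(n-2) + √((n-2)² + (n-1))`. -/
theorem star_graph_top_eigenvalue (n : ℕ) (hn : 3 ≤ n)
    (D : Matrix (Fin n) (Fin n) ℝ)
    (hD : ∀ i j : Fin n, D i j =
      if i = j then 0 else if i.val = 0 ∨ j.val = 0 then 1 else 2) :
    (∃ w : Fin n → ℝ, w ≠ 0 ∧
        D.mulVec w = ((n : ℝ) - 2 + Real.sqrt (((n : ℝ) - 2) ^ 2 + ((n : ℝ) - 1))) • w) ∧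
    (∀ t : ℝ, (∃ w : Fin n → ℝ, w ≠ 0 ∧ D.mulVec w = t • w) →
        t ≤ (n : ℝ) - 2 + Real.sqrt (((n : ℝ) - 2) ^ 2 + ((n : ℝ) - 1))) := by
  obtain ⟨m, rfl⟩ : ∃ m, n = m + 1 := ⟨n - 1, by omega⟩
  have hm : (2 : ℝ) ≤ m := by exact_mod_cast (by omega : 2 ≤ m)
  push_cast
  set r : ℝ := Real.sqrt (((m : ℝ) + 1 - 2) ^ 2 + ((m : ℝ) + 1 - 1))
  have hr_nonneg : 0 ≤ r := Real.sqrt_nonneg _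
  have hr_sq : r ^ 2 = ((m : ℝ) + 1 - 2) ^ 2 + ((m : ℝ) + 1 - 1) :=
    Real.sq_sqrt (by nlinarith)
  constructor
  · refine ⟨Fin.cons (m : ℝ) fun _ => (m : ℝ) + 1 - 2 + r, fun h => ?_, ?_⟩
    · have h0 := congrFun h 0
      simp only [Fin.cons_zero, Pi.zero_apply] at h0
      linarith
    · ext i
      refine Fin.cases ?_ (fun j => ?_) i
      · simp [star_mulVec_zero hD]
        ring
      · simp only [star_mulVec_succ hD, Fin.cons_zero, Fin.cons_succ, Finset.sum_const,
          Finset.card_univ, Fintype.card_fin, nsmul_eq_mul, Pi.smul_apply, smul_eq_mul]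
        linear_combination -hr_sq
  · rintro t ⟨w, hw, h⟩
    have hzero : ∑ j : Fin m, w j.succ = t * w 0 := by
      rw [← star_mulVec_zero hD, h, Pi.smul_apply, smul_eq_mul]
    have hsucc : ∀ i : Fin m, (t + 2) * w i.succ = (1 + 2 * t) * w 0 := by
      intro i
      have hi := star_mulVec_succ hD w i
      rw [h, hzero, Pi.smul_apply, smul_eq_mul] at hi
      linear_combination hi
    by_cases hw0 : w 0 = 0
    · obtain ⟨i, hi⟩ : ∃ i : Fin m, w i.succ ≠ 0 := by
        by_contra! hall
        exact hw (funext fun i => Fin.cases hw0 hall i)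
      have hmul := hsucc i
      rw [hw0, mul_zero] at hmul
      have ht := (mul_eq_zero.mp hmul).resolve_right hi
      linarith
    · have hsum : (t + 2) * (t * w 0) = m * ((1 + 2 * t) * w 0) := by
        rw [← hzero, Finset.mul_sum, Finset.sum_congr rfl fun i _ => hsucc i]
        simp
      have hquad : (t + 2) * t = m * (1 + 2 * t) :=
        mul_right_cancel₀ hw0 (by linear_combination hsum)
      have hle : t - ((m : ℝ) + 1 - 2) ≤ r :=
        Real.le_sqrt_of_sq_le (by linear_combination hquad)
      linarith
end

section
/- For n ≥ 3, let D^{(n)} ∈ ℝ^{n×n} be the distance matrix of the star graph on n vertices (vertex 1 the center: D_{1j} = 1 for j ≥ 2, D_{jk} = 2 for distinct j,k ≥ 2, zero diagonal), and let v^{(n)} ∈ ℝ^n be the unit-norm eigenvector with nonnegative entries associated to the largest eigenvalue of D^{(n)}. Then the entry a_n = v^{(n)}_1 at the central vertex satisfies lim_{n→∞} √n · a_n = 1/2. In particular, the bound min_i v_i ≥ 1/(2√n) of the main theorem is asymptotically sharp. -/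
open Finset Filter

/-- In a nonnegative unit eigenvector of the star distance matrix with `m ≥ 1` leaves, every leaf
entry is `c` times the central entry, where `c` lies within `3 / (2 m)` of `2`; normalization then
determines the central entry. -/
lemma star_eigenvector_center_sq {m : ℕ} (hm : 1 ≤ m)
    {D : Matrix (Fin (m + 1)) (Fin (m + 1)) ℝ}
    (hD : ∀ i j, D i j = if i = j then 0 else if i.val = 0 ∨ j.val = 0 then 1 else 2)
    {v : Fin (m + 1) → ℝ} {μ : ℝ} (hnonneg : ∀ i, 0 ≤ v i) (hnorm : ∑ i, v i ^ 2 = 1)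
    (heig : D.mulVec v = μ • v) :
    ∃ c : ℝ, 2 - 3 / (2 * m) ≤ c ∧ c ≤ 2 ∧ v 0 ^ 2 * (1 + m * c ^ 2) = 1 := by
  have hm' : (1 : ℝ) ≤ m := by exact_mod_cast hm
  have hcenter : ∑ j : Fin m, v j.succ = μ * v 0 := by
    have h := congrFun heig 0
    simpa [Matrix.mulVec, dotProduct, Fin.sum_univ_succ, hD, Fin.succ_ne_zero,
      (Fin.succ_ne_zero _).symm] using h
  have hleaf (j : Fin m) : v 0 + 2 * ∑ i : Fin m, v i.succ = (μ + 2) * v j.succ := by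
    have h := congrFun heig j.succ
    have hsum : ∑ i : Fin m, D j.succ i.succ * v i.succ
        = 2 * ∑ i : Fin m, v i.succ - 2 * v j.succ := by
      have hterm (i : Fin m) : D j.succ i.succ * v i.succ
          = 2 * v i.succ - if j = i then 2 * v i.succ else 0 := by
        by_cases hij : j = i <;> simp [hD, hij]
      simp [hterm, Finset.mul_sum]
    have h0 : D j.succ 0 = 1 := by simp [hD]
    simp only [Matrix.mulVec, dotProduct, Fin.sum_univ_succ, hsum, h0, Pi.smul_apply,
      smul_eq_mul] at h
    linarith
  have hS : 0 ≤ ∑ j : Fin m, v j.succ := Finset.sum_nonneg fun j _ => hnonneg _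
  have hpos : 0 < v 0 := by
    refine (hnonneg 0).lt_of_ne fun h0 => ?_
    rw [← h0, mul_zero] at hcenter
    have hz := (Finset.sum_eq_zero_iff_of_nonneg fun j _ => hnonneg _).1 hcenter
    simp [Fin.sum_univ_succ, ← h0, fun j => hz j (Finset.mem_univ j)] at hnorm
  have hμ : 0 ≤ μ := nonneg_of_mul_nonneg_left (hcenter ▸ hS) hpos
  set c := (1 + 2 * μ) / (μ + 2) with hc
  have hleaf' (j : Fin m) : v j.succ = c * v 0 := by
    have h := hleaf j
    rw [hcenter] at h
    rw [hc]
    field_simp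
    linarith
  have hchar : m * (1 + 2 * μ) = μ * (μ + 2) := by
    simp only [hleaf', Finset.sum_const, Finset.card_univ, Fintype.card_fin,
      nsmul_eq_mul] at hcenter
    have h : m * c = μ := mul_right_cancel₀ hpos.ne' (by linarith)
    rw [hc, mul_div_assoc', div_eq_iff (by positivity)] at h
    exact h
  have hlarge : 2 * m ≤ μ + 2 := by
    by_contra! hlt
    nlinarith
  have hc' : c = 2 - 3 / (μ + 2) := by
    rw [hc]
    field_simp
    ring
  refine ⟨c, ?_, ?_, ?_⟩
  · rw [hc']
    gcongr
  · rw [hc']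
    have : 0 ≤ 3 / (μ + 2) := by positivity
    linarith
  · simp only [Fin.sum_univ_succ, hleaf', Finset.sum_const, Finset.card_univ, Fintype.card_fin,
      nsmul_eq_mul] at hnorm
    linarith

/-- For the star graph on `n ≥ 3` vertices (vertex with index `0` the center),
the entry `a_n` of the unit-norm nonnegative leading eigenvector of its distance
matrix at the central vertex satisfies `√n · a_n → 1/2` as `n → ∞`.
In particular, the bound `min_i v_i ≥ 1/(2√n)` is asymptotically sharp. -/
theorem star_graph_center_entry_limit
    (D : (n : ℕ) → Matrix (Fin n) (Fin n) ℝ)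
    (hD : ∀ n : ℕ, ∀ i j : Fin n, D n i j =
      if i = j then 0 else if i.val = 0 ∨ j.val = 0 then 1 else 2)
    (v : (n : ℕ) → Fin n → ℝ) (lam : ℕ → ℝ)
    (hv : ∀ n : ℕ, 3 ≤ n →
      (∀ i, 0 ≤ v n i) ∧ (∑ i, v n i ^ 2 = 1) ∧
      ((D n).mulVec (v n) = lam n • v n) ∧
      (∀ t : ℝ, (∃ w : Fin n → ℝ, w ≠ 0 ∧ (D n).mulVec w = t • w) → t ≤ lam n)) :
    Tendsto (fun k : ℕ => Real.sqrt (k + 3) * v (k + 3) ⟨0, by omega⟩)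
      atTop (nhds (1 / 2)) := by
  choose! c hlower hupper hcenter using fun k : ℕ =>
    let h := hv (k + 3) (by omega)
    star_eigenvector_center_sq (m := k + 2) (by omega) (hD (k + 3)) h.1 h.2.1 h.2.2.1
  have hinv : Tendsto (fun k : ℕ => 3 / (2 * ((k + 2 : ℕ) : ℝ))) atTop (nhds 0) :=
    tendsto_const_nhds.div_atTop (((tendsto_natCast_atTop_atTop (R := ℝ)).comp
      (tendsto_add_atTop_nat 2)).const_mul_atTop two_pos)
  have hc : Tendsto c atTop (nhds 2) :=
    tendsto_of_tendsto_of_tendsto_of_le_of_le (by simpa using hinv.const_sub 2)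
      tendsto_const_nhds hlower hupper
  have hn : Tendsto (fun k : ℕ => 1 / ((k : ℝ) + 3)) atTop (nhds 0) :=
    tendsto_const_nhds.div_atTop (tendsto_atTop_add_const_right _ _ tendsto_natCast_atTop_atTop)
  have hlim : Tendsto
      (fun k : ℕ => √((1 / ((k : ℝ) + 3) + (1 - 1 / ((k : ℝ) + 3)) * c k ^ 2)⁻¹))
      atTop (nhds (1 / 2)) := by
    have h := ((hn.add ((hn.const_sub 1).mul (hc.pow 2))).inv₀ (by norm_num)).sqrt
    have hhalf : √((0 + (1 - 0) * 2 ^ 2 : ℝ)⁻¹) = 1 / 2 := by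
      rw [Real.sqrt_eq_iff_mul_self_eq] <;> norm_num
    rwa [hhalf] at h
  refine hlim.congr fun k => ?_
  have hk : (0 : ℝ) < k + 3 := by positivity
  have h := hcenter k
  push_cast at h
  have hnonneg : 0 ≤ v (k + 3) 0 := (hv (k + 3) (by omega)).1 0
  have hsq : (1 / ((k : ℝ) + 3) + (1 - 1 / ((k : ℝ) + 3)) * c k ^ 2)⁻¹
      = (k + 3) * v (k + 3) 0 ^ 2 := by
    refine inv_eq_of_mul_eq_one_right ?_
    field_simp
    linarith
  rw [hsq, Real.sqrt_mul hk.le, Real.sqrt_sq hnonneg]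
  rfl
end

section
/- For n ≥ 1, let D ∈ ℝ^{(n+1)×(n+1)} be the symmetric matrix with D_{ij} = 0 for 1 ≤ i,j ≤ n, D_{i,n+1} = D_{n+1,i} = 1 for 1 ≤ i ≤ n, and D_{n+1,n+1} = 0. Then the vector v ∈ ℝ^{n+1} with v_i = 1/√(2n) for 1 ≤ i ≤ n and v_{n+1} = 1/√2 is a unit-norm eigenvector of D with eigenvalue √n, √n is the largest eigenvalue of D, and ⟨v, 𝟙⟩/√(n+1) = (√n + 1)/(√2 · √(n+1)), which converges to 1/√2 as n → ∞. In particular, the bound ⟨v, 𝟙⟩ ≥ √n/√2 of the main theorem is asymptotically sharp. -/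
open Finset Filter

section StarMatrix

variable {n : ℕ} {D : Matrix (Fin (n + 1)) (Fin (n + 1)) ℝ}

theorem star_mulVec_castSucc
    (hD : ∀ i j : Fin (n + 1), D i j =
      if (i.val < n ∧ j.val = n) ∨ (i.val = n ∧ j.val < n) then 1 else 0)
    (w : Fin (n + 1) → ℝ) (i : Fin n) :
    D.mulVec w i.castSucc = w (Fin.last n) := by
  simp [Matrix.mulVec, dotProduct, Fin.sum_univ_castSucc, hD, fun j : Fin n => j.isLt.ne]

theorem star_mulVec_last
    (hD : ∀ i j : Fin (n + 1), D i j =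
      if (i.val < n ∧ j.val = n) ∨ (i.val = n ∧ j.val < n) then 1 else 0)
    (w : Fin (n + 1) → ℝ) :
    D.mulVec w (Fin.last n) = ∑ i : Fin n, w i.castSucc := by
  simp [Matrix.mulVec, dotProduct, Fin.sum_univ_castSucc, hD]

theorem star_eigenvalue_le_sqrt
    (hD : ∀ i j : Fin (n + 1), D i j =
      if (i.val < n ∧ j.val = n) ∨ (i.val = n ∧ j.val < n) then 1 else 0)
    {t : ℝ} {w : Fin (n + 1) → ℝ} (hw : w ≠ 0) (h : D.mulVec w = t • w) :
    t ≤ Real.sqrt n := by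
  by_contra! hlt
  have ht : 0 < t := (Real.sqrt_nonneg _).trans_lt hlt
  have hinit (i : Fin n) : w (Fin.last n) = t * w i.castSucc := by
    rw [← star_mulVec_castSucc hD w i, h]; rfl
  have hlast : ∑ i : Fin n, w i.castSucc = t * w (Fin.last n) := by
    rw [← star_mulVec_last hD w, h]; rfl
  have hsq : (n : ℝ) < t ^ 2 := (Real.sqrt_lt' ht).1 hlt
  have hmul : n * w (Fin.last n) = t ^ 2 * w (Fin.last n) := by
    calc n * w (Fin.last n) = ∑ _i : Fin n, w (Fin.last n) := by simp
      _ = ∑ i : Fin n, t * w i.castSucc := Finset.sum_congr rfl fun i _ => hinit i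
      _ = t ^ 2 * w (Fin.last n) := by rw [← Finset.mul_sum, hlast]; ring
  have hzero : w (Fin.last n) = 0 := by
    by_contra hne
    exact hsq.ne (mul_right_cancel₀ hne hmul)
  refine hw (funext fun i => ?_)
  induction i using Fin.lastCases with
  | last => exact hzero
  | cast i => exact (mul_eq_zero.1 ((hinit i).symm.trans hzero)).resolve_left ht.ne'

end StarMatrix

theorem tendsto_sqrt_add_one_div_sqrt_two_mul_sqrt :
    Tendsto (fun m : ℕ => (Real.sqrt m + 1) / (Real.sqrt 2 * Real.sqrt (m + 1)))
      atTop (nhds (1 / Real.sqrt 2)) := by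
  have hratio : Tendsto (fun m : ℕ => Real.sqrt (m / (m + 1))) atTop (nhds 1) := by
    simpa using (tendsto_natCast_div_add_atTop (1 : ℝ)).sqrt
  have hinv : Tendsto (fun m : ℕ => Real.sqrt (1 / (m + 1))) atTop (nhds 0) := by
    simpa using (tendsto_one_div_add_atTop_nhds_zero_nat (𝕜 := ℝ)).sqrt
  have hsum := (hratio.add hinv).div_const (Real.sqrt 2)
  rw [add_zero] at hsum
  refine hsum.congr fun m => ?_
  rw [Real.sqrt_div (by positivity), Real.sqrt_div (by positivity), Real.sqrt_one]
  field_simp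

/-- Sharpness of the bound `⟨v,𝟙⟩ ≥ √n/√2`: for the (degenerate) distance
matrix `D` of `n+1` points of which the first `n` coincide and the last is at
distance `1` from the others, the vector with entries `1/√(2n)` (first `n`) and
`1/√2` (last) is a unit eigenvector for the eigenvalue `√n`, which is the
largest eigenvalue, and `⟨v,𝟙⟩/√(n+1) = (√n + 1)/(√2·√(n+1)) → 1/√2`. -/
theorem sharpness_metric_space (n : ℕ) (hn : 1 ≤ n)
    (D : Matrix (Fin (n + 1)) (Fin (n + 1)) ℝ)
    (hD : ∀ i j : Fin (n + 1), D i j =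
      if (i.val < n ∧ j.val = n) ∨ (i.val = n ∧ j.val < n) then 1 else 0)
    (v : Fin (n + 1) → ℝ)
    (hv : ∀ i : Fin (n + 1),
      v i = if i.val < n then 1 / Real.sqrt (2 * n) else 1 / Real.sqrt 2) :
    (∑ i, v i ^ 2 = 1) ∧
    D.mulVec v = Real.sqrt n • v ∧
    (∀ t : ℝ, (∃ w : Fin (n + 1) → ℝ, w ≠ 0 ∧ D.mulVec w = t • w) →
      t ≤ Real.sqrt n) ∧
    (∑ i, v i) / Real.sqrt (n + 1)
      = (Real.sqrt n + 1) / (Real.sqrt 2 * Real.sqrt (n + 1)) ∧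
    Tendsto (fun m : ℕ => (Real.sqrt m + 1) / (Real.sqrt 2 * Real.sqrt (m + 1)))
      atTop (nhds (1 / Real.sqrt 2)) := by
  have hpos : (0 : ℝ) < n := by exact_mod_cast hn
  have hn0 : Real.sqrt n ≠ 0 := (Real.sqrt_pos.2 hpos).ne'
  have hnn : Real.sqrt n ^ 2 = n := Real.sq_sqrt hpos.le
  have htwo : Real.sqrt 2 ^ 2 = 2 := Real.sq_sqrt zero_le_two
  have hinit (i : Fin n) : v i.castSucc = 1 / (Real.sqrt 2 * Real.sqrt n) := by
    simp [hv]
  have hlast : v (Fin.last n) = 1 / Real.sqrt 2 := by simp [hv]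
  have hsum : ∑ i : Fin n, v i.castSucc = Real.sqrt n / Real.sqrt 2 := by
    simp only [hinit, Finset.sum_const, Finset.card_univ, Fintype.card_fin, nsmul_eq_mul]
    field_simp
    exact hnn.symm
  refine ⟨?_, ?_, fun t ⟨w, hw, h⟩ => star_eigenvalue_le_sqrt hD hw h, ?_,
    tendsto_sqrt_add_one_div_sqrt_two_mul_sqrt⟩
  · simp only [Fin.sum_univ_castSucc, hinit, hlast, Finset.sum_const, Finset.card_univ,
      Fintype.card_fin, nsmul_eq_mul, div_pow, mul_pow, hnn, htwo]
    field_simp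
    norm_num
  · funext i
    induction i using Fin.lastCases with
    | last =>
      rw [star_mulVec_last hD, hsum, Pi.smul_apply, smul_eq_mul, hlast, mul_one_div]
    | cast i =>
      rw [star_mulVec_castSucc hD, Pi.smul_apply, smul_eq_mul, hlast, hinit]
      field_simp
  · rw [Fin.sum_univ_castSucc, hsum, hlast, ← add_div, div_div]
end
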